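/- arXiv:2307.07908 — 2 statements merged into one kernel-verified Lean document; each statement's English description precedes it below -/
import Mathlib

section
/- For every 2×2 unitary matrix V with determinant 1, there exist 2×2 unitary matrices A, B, C with A·B·C = I₂ such that ∧(V) = (I₂ ⊗ A) · CNOT · (I₂ ⊗ B) · CNOT · (I₂ ⊗ C); that is, every controlled special unitary decomposes into single-qubit gates and two CNOT gates. -/
open Matrix Kronecker

noncomputable section

abbrev M2 := Matrix (Fin 2) (Fin 2) ℂ
abbrev M4 := Matrix (Fin 2 × Fin 2) (Fin 2 × Fin 2) ℂ

/-- computational basis ket `|b⟩` of `ℂ²`, as a 2×1 matrix -/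
def ket (b : Fin 2) : Matrix (Fin 2) (Fin 1) ℂ := Matrix.of fun i _ => if i = b then 1 else 0

/-- computational basis bra `⟨b|` -/
def bra (b : Fin 2) : Matrix (Fin 1) (Fin 2) ℂ := Matrix.of fun _ j => if j = b then 1 else 0

/-- rank-one projector `|b⟩⟨b|` -/
def proj (b : Fin 2) : M2 := ket b * bra b

/-- Pauli X -/
def Xg : M2 := !![0, 1; 1, 0]

/-- CNOT with control on the first factor -/
def CNOT : M4 := proj 0 ⊗ₖ (1 : M2) + proj 1 ⊗ₖ Xg

/-- the controlled gate `∧(U) = |0⟩⟨0|⊗I₂ + |1⟩⟨1|⊗U` -/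
def CU (U : M2) : M4 := proj 0 ⊗ₖ (1 : M2) + proj 1 ⊗ₖ U

lemma proj_mul_self (b : Fin 2) : proj b * proj b = proj b := by
  ext i j
  fin_cases b <;> fin_cases i <;> fin_cases j <;> simp [proj, ket, bra, Matrix.mul_apply]

lemma proj_mul_of_ne {b c : Fin 2} (h : b ≠ c) : proj b * proj c = 0 := by
  have key : bra b * ket c = 0 := by
    ext i j
    simp [bra, ket, Matrix.mul_apply, h.symm]
  rw [proj, proj, Matrix.mul_assoc, ← Matrix.mul_assoc (bra b), key, Matrix.zero_mul,
    Matrix.mul_zero]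

lemma proj_zero_add_proj_one : proj 0 + proj 1 = 1 := by
  ext i j
  fin_cases i <;> fin_cases j <;> simp [proj, ket, bra, Matrix.mul_apply]

/-- Block-diagonal operators, with blocks selected by the first factor, multiply blockwise. -/
lemma proj_kronecker_mul (P Q R S : M2) :
    (proj 0 ⊗ₖ P + proj 1 ⊗ₖ Q) * (proj 0 ⊗ₖ R + proj 1 ⊗ₖ S) =
      proj 0 ⊗ₖ (P * R) + proj 1 ⊗ₖ (Q * S) := by
  simp [add_mul, mul_add, ← Matrix.mul_kronecker_mul, proj_mul_self, proj_mul_of_ne]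

lemma one_kronecker_eq (A : M2) : (1 : M2) ⊗ₖ A = proj 0 ⊗ₖ A + proj 1 ⊗ₖ A := by
  rw [← Matrix.add_kronecker, proj_zero_add_proj_one]

lemma CNOT_circuit_eq (A B C : M2) :
    ((1 : M2) ⊗ₖ A) * CNOT * ((1 : M2) ⊗ₖ B) * CNOT * ((1 : M2) ⊗ₖ C) =
      proj 0 ⊗ₖ (A * B * C) + proj 1 ⊗ₖ (A * Xg * B * Xg * C) := by
  simp only [one_kronecker_eq, CNOT, proj_kronecker_mul, Matrix.mul_one]

lemma conjTranspose_eq_adjugate {V : M2} (hV : Vᴴ * V = 1) (hdet : V.det = 1) :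
    Vᴴ = V.adjugate := by
  calc Vᴴ = Vᴴ * (V * V.adjugate) := by rw [Matrix.mul_adjugate, hdet, one_smul, Matrix.mul_one]
    _ = V.adjugate := by rw [← Matrix.mul_assoc, hV, Matrix.one_mul]

/-- The special unitary matrix with first column `(p, q)`, when `(p, q)` is a unit vector. -/
def suOfColumn (p q : ℂ) : M2 := !![p, -star q; q, star p]

lemma suOfColumn_conjTranspose_mul_self {p q : ℂ} (h : star p * p + star q * q = 1) :
    (suOfColumn p q)ᴴ * suOfColumn p q = 1 := by
  ext i j
  fin_cases i <;> fin_cases j <;>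
    simp [suOfColumn, Matrix.mul_apply, Fin.sum_univ_two] at h ⊢
  · linear_combination h
  · ring
  · ring
  · linear_combination h

lemma eq_suOfColumn {V : M2} (hV : Vᴴ * V = 1) (hdet : V.det = 1) :
    V = suOfColumn (V 0 0) (V 1 0) := by
  have h := conjTranspose_eq_adjugate hV hdet
  have h00 := congrFun (congrFun h 0) 0
  have h01 := congrFun (congrFun h 0) 1
  simp [Matrix.adjugate_fin_two] at h00 h01
  ext i j
  fin_cases i <;> fin_cases j <;> simp [suOfColumn, h00, h01]

lemma exists_unit_eigenvector (V : M2) :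
    ∃ l p q : ℂ, star p * p + star q * q = 1 ∧ V 0 0 * p + V 0 1 * q = l * p ∧
      V 1 0 * p + V 1 1 * q = l * q := by
  obtain ⟨l, hl⟩ := Module.End.exists_eigenvalue (Matrix.toLin' V)
  obtain ⟨v, hv⟩ := hl.exists_hasEigenvector
  have hne : ‖WithLp.toLp 2 v‖ ≠ 0 := by simpa using hv.2
  have hnorm : star (v 0) * v 0 + star (v 1) * v 1 = (‖WithLp.toLp 2 v‖ : ℂ) ^ 2 := by
    rw [← Complex.ofReal_pow, EuclideanSpace.norm_sq_eq]
    simp [Fin.sum_univ_two, Complex.conj_mul']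
  have hne' : (‖WithLp.toLp 2 v‖ : ℂ) ≠ 0 := by exact_mod_cast hne
  generalize ‖WithLp.toLp 2 v‖ = r at *
  have he := hv.apply_eq_smul
  have h0 := congrFun he 0
  have h1 := congrFun he 1
  simp [Matrix.mulVec, dotProduct, Fin.sum_univ_two] at h0 h1
  refine ⟨l, v 0 / r, v 1 / r, ?_, ?_, ?_⟩
  · simp at hnorm ⊢
    field_simp
    linear_combination hnorm
  · linear_combination h0 / r
  · linear_combination h1 / r

/-- Every special unitary `2 × 2` matrix is unitarily similar to `diag(m², (star m)²)` for some
`m` on the unit circle. -/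
lemma exists_unitary_diagonalization {V : M2} (hV : Vᴴ * V = 1) (hdet : V.det = 1) :
    ∃ (A : M2) (m : ℂ), Aᴴ * A = 1 ∧ star m * m = 1 ∧
      V = A * !![m ^ 2, 0; 0, star m ^ 2] * Aᴴ := by
  obtain ⟨l, p, q, hpq, h0, h1⟩ := exists_unit_eigenvector V
  obtain ⟨m, rfl⟩ : ∃ m : ℂ, l = m ^ 2 :=
    (IsAlgClosed.exists_pow_nat_eq l two_pos).imp fun _ h => h.symm
  have hVu := eq_suOfColumn hV hdet
  have hA := suOfColumn_conjTranspose_mul_self hpq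
  have hVA : V * suOfColumn p q = suOfColumn p q * !![m ^ 2, 0; 0, star m ^ 2] := by
    have e01 : V 0 1 = -star (V 1 0) := congrFun (congrFun hVu 0) 1
    have e11 : V 1 1 = star (V 0 0) := congrFun (congrFun hVu 1) 1
    rw [e01] at h0
    rw [e11] at h1
    have h0' := congrArg star h0
    have h1' := congrArg star h1
    simp at h0 h1 h0' h1'
    ext i j
    fin_cases i <;> fin_cases j <;>
      simp [suOfColumn, Matrix.mul_apply, Fin.sum_univ_two, e01, e11]
    · linear_combination h0
    · linear_combination -h1'
    · linear_combination h1
    · linear_combination h0'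
  have hA' := mul_eq_one_comm.mp hA
  have hVeq : V = suOfColumn p q * !![m ^ 2, 0; 0, star m ^ 2] * (suOfColumn p q)ᴴ := by
    rw [← hVA, Matrix.mul_assoc, hA', Matrix.mul_one]
  refine ⟨suOfColumn p q, m, hA, ?_, hVeq⟩
  have hd : (m ^ 2) * (star m ^ 2) = 1 := by
    have := congrArg Matrix.det hVA
    have hu : (suOfColumn p q).det = 1 := by
      simp [suOfColumn, Matrix.det_fin_two] at hpq ⊢
      linear_combination hpq
    simpa [Matrix.det_mul, hdet, hu, Matrix.det_fin_two] using this.symm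
  have hm : ((‖m‖ : ℂ) ^ 2) = 1 := by
    have h4 : ‖m‖ ^ 4 = 1 := by
      have := congrArg norm hd
      simp at this
      linear_combination this
    have : ‖m‖ = 1 := (pow_eq_one_iff_of_nonneg (norm_nonneg m) (by norm_num)).mp h4
    simp [this]
  simpa [Complex.conj_mul'] using hm

/-- Every controlled special unitary decomposes into single-qubit gates `A, B, C` with
`A·B·C = I₂` and two CNOT gates. -/
theorem controlled_special_unitary_ABC (V : M2) (hV : Vᴴ * V = 1) (hdet : V.det = 1) :
    ∃ A B C : M2, Aᴴ * A = 1 ∧ Bᴴ * B = 1 ∧ Cᴴ * C = 1 ∧ A * B * C = 1 ∧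
      CU V = ((1 : M2) ⊗ₖ A) * CNOT * ((1 : M2) ⊗ₖ B) * CNOT * ((1 : M2) ⊗ₖ C) := by
  obtain ⟨A, m, hA, hm, hVA⟩ := exists_unitary_diagonalization hV hdet
  have hA' : A * Aᴴ = 1 := mul_eq_one_comm.mp hA
  obtain ⟨B, hBdef⟩ : ∃ B : M2, B = !![star m, 0; 0, m] := ⟨_, rfl⟩
  have hB : Bᴴ * B = 1 := by
    simp only [Complex.star_def] at hm
    ext i j
    fin_cases i <;> fin_cases j <;>
      simp [hBdef, Matrix.mul_apply, Fin.sum_univ_two] <;> linear_combination hm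
  have hB' : B * Bᴴ = 1 := mul_eq_one_comm.mp hB
  have hX : Xg * B * Xg * Bᴴ = !![m ^ 2, 0; 0, star m ^ 2] := by
    ext i j
    fin_cases i <;> fin_cases j <;>
      simp [hBdef, Xg, Matrix.mul_apply, Fin.sum_univ_two, sq]
  have hABC : A * B * (Bᴴ * Aᴴ) = 1 := by
    rw [Matrix.mul_assoc, ← Matrix.mul_assoc B, hB', Matrix.one_mul, hA']
  refine ⟨A, B, Bᴴ * Aᴴ, hA, hB, ?_, hABC, ?_⟩
  · rw [← Matrix.conjTranspose_mul, Matrix.conjTranspose_conjTranspose, ← hABC,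
      Matrix.conjTranspose_mul]
  · rw [CNOT_circuit_eq, hABC, CU, hVA, ← hX]
    simp only [Matrix.mul_assoc]
end
end

section
/- Heralded noiseless branch of the indefinite causal order of a bit-flip and a phase-flip channel: let p, q ∈ [0,1], and define the Kraus operators N₀ = √p·X, N₁ = √(1−p)·I₂, M₀ = √q·Z, M₁ = √(1−q)·I₂. Then for every 2×2 complex matrix σ, Σ_{n,m ∈ {0,1}} (1/4)·(N_n M_m − M_m N_n) · σ · (N_n M_m − M_m N_n)ᴴ = p·q·(Y σ Y); that is, the branch of the causally superposed channel heralded by measuring the control qubit (prepared in |+⟩) in the state |−⟩ equals the unitary channel Y σ Y with weight pq. -/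
open Matrix

noncomputable section

/-- Pauli Y -/
def Yg : M2 := !![0, -Complex.I; Complex.I, 0]

/-- Pauli Z -/
def Zg : M2 := !![1, 0; 0, -1]

/-- Kraus operators of the bit-flip channel: `N₀ = √p·X`, `N₁ = √(1−p)·I₂` -/
def Nk (p : ℝ) : Fin 2 → M2 :=
  ![(Real.sqrt p : ℂ) • Xg, (Real.sqrt (1 - p) : ℂ) • (1 : M2)]

/-- Kraus operators of the phase-flip channel: `M₀ = √q·Z`, `M₁ = √(1−q)·I₂` -/
def Mk (q : ℝ) : Fin 2 → M2 :=
  ![(Real.sqrt q : ℂ) • Zg, (Real.sqrt (1 - q) : ℂ) • (1 : M2)]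

/-- The commutator of the Pauli matrices `X` and `Z` is `-2i·Y`. -/
theorem Xg_mul_Zg_sub_Zg_mul_Xg : Xg * Zg - Zg * Xg = (-2 * Complex.I) • Yg := by
  ext i j
  fin_cases i <;> fin_cases j <;> simp [Xg, Yg, Zg, mul_assoc] <;> norm_num

theorem Yg_conjTranspose : Ygᴴ = Yg := by
  ext i j
  fin_cases i <;> fin_cases j <;> simp [Yg]

theorem Nk_Mk_commutator_zero_zero (p q : ℝ) :
    Nk p 0 * Mk q 0 - Mk q 0 * Nk p 0 =
      ((Real.sqrt p : ℂ) * (Real.sqrt q : ℂ) * (-2 * Complex.I)) • Yg := by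
  rw [mul_smul, ← Xg_mul_Zg_sub_Zg_mul_Xg]
  simp only [Nk, Mk, cons_val_zero, smul_mul_assoc, mul_smul_comm, smul_smul, smul_sub,
    mul_comm (Real.sqrt q : ℂ)]

theorem Complex.ofReal_sqrt_mul_self {r : ℝ} (hr : 0 ≤ r) :
    (Real.sqrt r : ℂ) * (Real.sqrt r : ℂ) = r := by
  rw [← Complex.ofReal_mul, Real.mul_self_sqrt hr]

/-- Heralded noiseless branch of the indefinite causal order of a bit-flip and a
phase-flip channel: the branch heralded by measuring the control qubit in `|−⟩` is
`Σ_{n,m} (1/4)(N_nM_m − M_mN_n) σ (N_nM_m − M_mN_n)ᴴ = p·q·(Y σ Y)`. -/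
theorem heralded_branch_is_Y_channel (p q : ℝ) (hp : p ∈ Set.Icc (0 : ℝ) 1)
    (hq : q ∈ Set.Icc (0 : ℝ) 1) (σ : M2) :
    ∑ n : Fin 2, ∑ m : Fin 2,
        ((1 : ℂ) / 4) • ((Nk p n * Mk q m - Mk q m * Nk p n) * σ *
          (Nk p n * Mk q m - Mk q m * Nk p n)ᴴ) =
      ((p : ℂ) * (q : ℂ)) • (Yg * σ * Yg) := by
  have h01 : Nk p 0 * Mk q 1 - Mk q 1 * Nk p 0 = 0 := by simp [Nk, Mk, smul_smul, mul_comm]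
  have h10 : Nk p 1 * Mk q 0 - Mk q 0 * Nk p 1 = 0 := by simp [Nk, Mk, smul_smul, mul_comm]
  have h11 : Nk p 1 * Mk q 1 - Mk q 1 * Nk p 1 = 0 := by simp [Nk, Mk, smul_smul, mul_comm]
  simp only [Fin.sum_univ_two, h01, h10, h11, Nk_Mk_commutator_zero_zero, conjTranspose_smul,
    Yg_conjTranspose, zero_mul, smul_zero, add_zero, smul_mul_assoc, mul_smul_comm, smul_smul]
  congr 1
  simp only [star_mul', star_neg, Complex.star_def, Complex.conj_I, Complex.conj_ofReal,
    Complex.conj_ofNat]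
  rw [← Complex.ofReal_sqrt_mul_self hp.1, ← Complex.ofReal_sqrt_mul_self hq.1]
  linear_combination (-(Real.sqrt p : ℂ) ^ 2 * (Real.sqrt q : ℂ) ^ 2) * Complex.I_sq
end
end
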